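/- Let g ≥ 2 be an integer and let F : ℝ^{n+2} → ℝ be an isoparametric polynomial of degree g, i.e. the evaluation of a homogeneous polynomial of degree g satisfying ‖∇F(x)‖² = g²·‖x‖^{2g−2} and ΔF(x) = c·‖x‖^{g−2} for all x, for some constant c ∈ ℝ, and let Φ := (1/g)·∇F. Fix an integer k with 1 ≤ k ≤ g−1. If p, q ∈ S^{n+1} both satisfy arccos(F(p)) ∈ ((k−1)π/(g−1), kπ/(g−1)) and arccos(F(q)) ∈ ((k−1)π/(g−1), kπ/(g−1)), and Φ(p) = Φ(q), then p = q. (That is, Φ is injective on each open band 𝓜_k = ⋃_{τ ∈ ((k−1)π/(g(g−1)), kπ/(g(g−1)))} M_{cos(gτ)} of S^{n+1}.) -/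

import Mathlib

open Real

/-- The Euclidean Laplacian of a function on a finite-dimensional real inner product space,
computed as the sum of second derivatives along an orthonormal basis. -/
noncomputable def laplacian {E : Type*} [NormedAddCommGroup E] [InnerProductSpace ℝ E]
    [FiniteDimensional ℝ E] (f : E → ℝ) (x : E) : ℝ :=
  ∑ i, iteratedFDeriv ℝ 2 f x ![stdOrthonormalBasis ℝ E i, stdOrthonormalBasis ℝ E i]

open InnerProductSpace in
/-- The gradient of an analytic function is analytic. -/
lemma AnalyticAt.gradient_real {E : Type*} [NormedAddCommGroup E] [InnerProductSpace ℝ E]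
    [CompleteSpace E] {F : E → ℝ} {x : E} (hF : AnalyticAt ℝ F x) :
    AnalyticAt ℝ (gradient F) x := by
  let T : (E →L[ℝ] ℝ) →L[ℝ] E :=
    { toFun := (toDual ℝ E).symm
      map_add' := by simp
      map_smul' := by simp
      cont := (toDual ℝ E).symm.continuous }
  exact (T.analyticAt _).comp hF.fderiv

/-- The Hessian of an analytic function is symmetric. -/
lemma inner_fderiv_gradient_comm {E : Type*} [NormedAddCommGroup E] [InnerProductSpace ℝ E]
    [CompleteSpace E] {F : E → ℝ} {x : E} (hF : AnalyticAt ℝ F x) (v w : E) :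
    inner ℝ (fderiv ℝ (gradient F) x v) w = inner ℝ (fderiv ℝ (gradient F) x w) v := by
  have key : ∀ a b : E, inner ℝ (fderiv ℝ (gradient F) x a) b
      = fderiv ℝ (fderiv ℝ F) x a b := by
    intro a b
    have h1 : HasFDerivAt (fun y ↦ inner ℝ (gradient F y) b) _ x :=
      hF.gradient_real.differentiableAt.hasFDerivAt.inner ℝ (hasFDerivAt_const b x)
    have h2 : HasFDerivAt (fun y ↦ fderiv ℝ F y b) _ x :=
      hF.fderiv.differentiableAt.hasFDerivAt.clm_apply (hasFDerivAt_const b x)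
    simp_rw [inner_gradient_left] at h1
    have h3 := congrArg (fun L : E →L[ℝ] ℝ ↦ L a) (h1.unique h2)
    simpa using h3
  rw [key, key]
  exact hF.contDiffAt.isSymmSndFDerivAt_of_omega v w

/-- Euler's identity for homogeneous functions. -/
lemma inner_gradient_self_of_homogeneous {E : Type*} [NormedAddCommGroup E]
    [InnerProductSpace ℝ E] [CompleteSpace E] {F : E → ℝ} {g : ℕ}
    (hF : ∀ x, AnalyticAt ℝ F x) (hhom : ∀ (r : ℝ) x, F (r • x) = r ^ g * F x) (x : E) :
    inner ℝ (gradient F x) x = g * F x := by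
  have h1 : HasDerivAt (fun r : ℝ ↦ r • x) x 1 := by
    simpa using (hasDerivAt_id (1 : ℝ)).smul_const x
  have h2 : HasDerivAt (fun r : ℝ ↦ F (r • x)) (fderiv ℝ F x x) 1 := by
    have h := (hF ((1 : ℝ) • x)).differentiableAt.hasFDerivAt.comp_hasDerivAt (1 : ℝ) h1
    rw [one_smul] at h
    exact h
  have h3 : HasDerivAt (fun r : ℝ ↦ F (r • x)) (g * F x) 1 := by
    simp_rw [hhom]
    simpa using (hasDerivAt_pow g (1 : ℝ)).mul_const (F x)
  rw [inner_gradient_left, h2.unique h3]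

/-- The gradient of a homogeneous function is homogeneous, in infinitesimal form. -/
lemma fderiv_gradient_self_of_homogeneous {E : Type*} [NormedAddCommGroup E]
    [InnerProductSpace ℝ E] [CompleteSpace E] {F : E → ℝ} {g : ℕ}
    (hF : ∀ x, AnalyticAt ℝ F x) (hhom : ∀ (r : ℝ) x, F (r • x) = r ^ g * F x) (x : E) :
    fderiv ℝ (gradient F) x x = ((g : ℝ) - 1) • gradient F x := by
  refine ext_inner_right ℝ fun v ↦ ?_
  have h1 : HasFDerivAt (fun y ↦ inner ℝ (gradient F y) y) _ x :=
    (hF x).gradient_real.differentiableAt.hasFDerivAt.inner ℝ (hasFDerivAt_id x)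
  have h2 : HasFDerivAt (fun y ↦ (g : ℝ) * F y) _ x :=
    (hF x).differentiableAt.hasFDerivAt.const_mul (g : ℝ)
  simp_rw [inner_gradient_self_of_homogeneous hF hhom] at h1
  have h3 := congrArg (fun L : E →L[ℝ] ℝ ↦ L v) (h1.unique h2)
  simp at h3
  rw [inner_fderiv_gradient_comm (hF x), inner_smul_left]
  simp
  linarith

/-- The derivative of the eikonal equation at a point of the unit sphere. -/
lemma fderiv_gradient_gradient_of_eikonal {E : Type*} [NormedAddCommGroup E]
    [InnerProductSpace ℝ E] [CompleteSpace E] {F : E → ℝ} {g : ℕ} (hg : 1 ≤ g)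
    (hF : ∀ x, AnalyticAt ℝ F x)
    (heik : ∀ x, ‖gradient F x‖ ^ 2 = (g : ℝ) ^ 2 * ‖x‖ ^ (2 * g - 2)) {x : E}
    (hx : ‖x‖ = 1) :
    fderiv ℝ (gradient F) x (gradient F x) = ((g : ℝ) ^ 2 * ((g : ℝ) - 1)) • x := by
  refine ext_inner_right ℝ fun v ↦ ?_
  have h1 : HasFDerivAt (fun y ↦ ‖gradient F y‖ ^ 2) _ x :=
    (hF x).gradient_real.differentiableAt.hasFDerivAt.norm_sq
  have h2 : HasFDerivAt (fun y : E ↦ (g : ℝ) ^ 2 * (‖y‖ ^ 2) ^ (g - 1)) _ x :=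
    (((hasFDerivAt_id x).norm_sq).pow (g - 1)).const_mul ((g : ℝ) ^ 2)
  simp_rw [heik, show 2 * g - 2 = 2 * (g - 1) by lia, pow_mul] at h1
  have h3 := congrArg (fun L : E →L[ℝ] ℝ ↦ L v) (h1.unique h2)
  simp [hx, Nat.cast_sub hg] at h3
  rw [inner_fderiv_gradient_comm (hF x), inner_smul_left, real_inner_comm]
  simp
  linarith

/-- Along a great circle that starts in the direction of the gradient, the gradient of a solution
of the eikonal equation stays in the plane of the circle and is given explicitly. -/
lemma gradient_along_normal_circle {E : Type*} [NormedAddCommGroup E]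
    [InnerProductSpace ℝ E] [CompleteSpace E] {F : E → ℝ} {g : ℕ} (hg : 1 ≤ g)
    (hF : ∀ x, AnalyticAt ℝ F x) (hhom : ∀ (r : ℝ) x, F (r • x) = r ^ g * F x)
    (heik : ∀ x, ‖gradient F x‖ ^ 2 = (g : ℝ) ^ 2 * ‖x‖ ^ (2 * g - 2)) {p ν : E} {θ : ℝ}
    (hp : ‖p‖ = 1) (hν : ‖ν‖ = 1) (hpν : inner ℝ p ν = 0) (hθ : sin θ ≠ 0)
    (hgrad : gradient F p = (g : ℝ) • (cos θ • p + sin θ • ν)) (t : ℝ) :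
    gradient F (cos t • p + sin t • ν) = (g : ℝ) •
      (cos (θ - g * t) • (cos t • p + sin t • ν)
        + sin (θ - g * t) • (-sin t • p + cos t • ν)) := by
  have hg0 : (g : ℝ) ≠ 0 := by positivity
  let γ : ℝ → E := fun t ↦ cos t • p + sin t • ν
  let δ : ℝ → E := fun t ↦ -sin t • p + cos t • ν
  have hγnorm : ∀ t, ‖γ t‖ = 1 := by
    intro t
    have h : ‖γ t‖ ^ 2 = 1 := by
      simp only [γ, norm_add_sq_real, norm_smul, inner_smul_left, inner_smul_right, hpν, hp, hν]
      simp
    nlinarith [norm_nonneg (γ t)]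
  have hγ : ∀ t, HasDerivAt γ (δ t) t := fun t ↦
    ((hasDerivAt_cos t).smul_const p).add ((hasDerivAt_sin t).smul_const ν)
  have hδ : ∀ t, HasDerivAt δ (-γ t) t := by
    intro t
    refine (((hasDerivAt_sin t).neg.smul_const p).add
      ((hasDerivAt_cos t).smul_const ν)).congr_deriv ?_
    simp only [γ]
    module
  have hγ0 : γ 0 = p := by simp [γ]
  have hδ0 : δ 0 = ν := by simp [δ]
  have hγa : ∀ t, AnalyticAt ℝ γ t := fun t ↦
    (analyticAt_cos.smul analyticAt_const).add (analyticAt_sin.smul analyticAt_const)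
  have hδa : ∀ t, AnalyticAt ℝ δ t := fun t ↦
    (analyticAt_sin.neg.smul analyticAt_const).add (analyticAt_cos.smul analyticAt_const)
  let φ : ℝ → ℝ := fun t ↦ θ - g * t
  have hφ : ∀ t, HasDerivAt φ (-g) t := by
    intro t
    simpa using ((hasDerivAt_id t).const_mul (g : ℝ)).const_sub θ
  have hφ0 : φ 0 = θ := by simp [φ]
  have hφa : ∀ t, AnalyticAt ℝ φ t := fun t ↦
    analyticAt_const.sub (analyticAt_const.mul analyticAt_id)
  have hcosa : ∀ t, AnalyticAt ℝ (fun t ↦ cos (φ t)) t := fun t ↦ analyticAt_cos.comp (hφa t)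
  have hsina : ∀ t, AnalyticAt ℝ (fun t ↦ sin (φ t)) t := fun t ↦ analyticAt_sin.comp (hφa t)
  suffices h : ∀ t, gradient F (γ t) = (g : ℝ) • (cos (φ t) • γ t + sin (φ t) • δ t) from h t
  clear_value γ δ φ
  clear t
  let A : ℝ → E := fun t ↦ cos (φ t) • γ t + sin (φ t) • δ t
  let D : ℝ → E := fun t ↦ gradient F (γ t) - (g : ℝ) • A t
  have hA : ∀ t, HasDerivAt A (((g : ℝ) - 1) • (sin (φ t) • γ t - cos (φ t) • δ t)) t := by
    intro t
    refine (((hφ t).cos.smul (hγ t)).add ((hφ t).sin.smul (hδ t))).congr_deriv ?_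
    module
  let H : ℝ → E →L[ℝ] E := fun t ↦ fderiv ℝ (gradient F) (γ t)
  have hD : ∀ t, HasDerivAt D
      (H t (δ t) - (g : ℝ) • (((g : ℝ) - 1) • (sin (φ t) • γ t - cos (φ t) • δ t))) t := by
    intro t
    exact ((hF (γ t)).gradient_real.differentiableAt.hasFDerivAt.comp_hasDerivAt t (hγ t)).sub
      ((hA t).const_smul (g : ℝ))
  let L : ℝ → E →L[ℝ] E := fun t ↦
    -(sin (φ t))⁻¹ • ((g : ℝ)⁻¹ • H t
      + (((g : ℝ) - 1) * cos (φ t)) • ContinuousLinearMap.id ℝ E)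
  have hDL : ∀ t, sin (φ t) ≠ 0 → HasDerivAt D (L t (D t)) t := by
    intro t ht
    refine (hD t).congr_deriv ?_
    symm
    have e1 : H t (γ t) = ((g : ℝ) - 1) • gradient F (γ t) :=
      fderiv_gradient_self_of_homogeneous hF hhom (γ t)
    have e2 : H t (gradient F (γ t)) = ((g : ℝ) ^ 2 * ((g : ℝ) - 1)) • γ t :=
      fderiv_gradient_gradient_of_eikonal hg hF heik (hγnorm t)
    have e3 : H t (D t) = ((g : ℝ) ^ 2 * ((g : ℝ) - 1)) • γ t
        - (g : ℝ) • (cos (φ t) • ((g : ℝ) - 1) • gradient F (γ t) + sin (φ t) • H t (δ t)) := by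
      simp only [D, A, map_sub, map_smul, map_add, e1, e2]
    simp only [L, smul_apply, add_apply,
      ContinuousLinearMap.id_apply, e3]
    simp only [D, A]
    have hcs := sin_sq_add_cos_sq (φ t)
    clear_value H
    clear hD e1 e2 e3 hA
    generalize sin (φ t) = s at *
    generalize cos (φ t) = c at *
    match_scalars <;> field_simp <;> grind
  have hsinc : ContinuousAt (fun t ↦ sin (φ t)) 0 := (hsina 0).continuousAt
  have hsin : ∀ᶠ t in nhds (0 : ℝ), sin (φ t) ≠ 0 :=
    hsinc.eventually_ne (by simpa [hφ0] using hθ)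
  have hLc : ContinuousAt L 0 := by
    have hH : ContinuousAt H 0 :=
      ContinuousAt.comp (f := γ) (hF (γ 0)).gradient_real.fderiv.continuousAt (hγa 0).continuousAt
    have hs : ContinuousAt (fun t ↦ -(sin (φ t))⁻¹) 0 :=
      (hsinc.inv₀ (by simpa [hφ0] using hθ)).neg
    have hc : ContinuousAt (fun t ↦ ((g : ℝ) - 1) * cos (φ t)) 0 :=
      continuousAt_const.mul (hcosa 0).continuousAt
    have hI : ContinuousAt (fun _ : ℝ ↦ ContinuousLinearMap.id ℝ E) 0 := continuousAt_const
    exact hs.smul ((hH.const_smul (g : ℝ)⁻¹).add (hc.smul hI))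
  have hK : ∀ᶠ t in nhds (0 : ℝ), ‖L t‖₊ < ‖L 0‖₊ + 1 :=
    hLc.nnnorm.eventually_lt continuousAt_const (by simp)
  have hD0 : D 0 = 0 := by simp [D, A, hγ0, hδ0, hφ0, hgrad]
  have hloc : D =ᶠ[nhds 0] fun _ ↦ (0 : E) := by
    refine ODE_solution_unique_of_eventually (v := fun t x ↦ L t x) (s := fun _ ↦ Set.univ)
      (K := ‖L 0‖₊ + 1) ?_ ?_ ?_ hD0
    · filter_upwards [hK] with t ht
      exact ((L t).lipschitz.weaken ht.le).lipschitzOnWith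
    · filter_upwards [hsin] with t ht
      exact ⟨hDL t ht, Set.mem_univ _⟩
    · filter_upwards with t
      simpa using hasDerivAt_const t (0 : E)
  have hDan : AnalyticOnNhd ℝ D Set.univ := by
    intro t _
    exact ((hF (γ t)).gradient_real.comp (hγa t)).sub (analyticAt_const.smul
      (((hcosa t).smul (hγa t)).add ((hsina t).smul (hδa t))))
  have hzero : D = fun _ ↦ (0 : E) := hDan.eq_of_eventuallyEq analyticOnNhd_const hloc
  exact fun t ↦ sub_eq_zero.mp (congrFun hzero t)

/-- A point `p` of the sphere, off the focal sets, lies on the unit circle through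
`Φ p = g⁻¹ ∇F p` in a direction `w` determined by `∇F (Φ p)`. -/
lemma exists_normal_direction_at_gradientMap {E : Type*} [NormedAddCommGroup E]
    [InnerProductSpace ℝ E] [CompleteSpace E] {F : E → ℝ} {g : ℕ} (hg : 1 ≤ g)
    (hF : ∀ x, AnalyticAt ℝ F x) (hhom : ∀ (r : ℝ) x, F (r • x) = r ^ g * F x)
    (heik : ∀ x, ‖gradient F x‖ ^ 2 = (g : ℝ) ^ 2 * ‖x‖ ^ (2 * g - 2)) {p y : E} {θ : ℝ}
    (hp : ‖p‖ = 1) (hFp : F p = cos θ) (hθ : sin θ ≠ 0)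
    (hy : y = (g : ℝ)⁻¹ • gradient F p) :
    F y = cos (((g : ℝ) - 1) * θ) ∧ ∃ w : E, p = cos θ • y - sin θ • w ∧
      gradient F y
        = (g : ℝ) • (cos (((g : ℝ) - 1) * θ) • y - sin (((g : ℝ) - 1) * θ) • w) := by
  have hg0 : (g : ℝ) ≠ 0 := by positivity
  have hG : gradient F p = (g : ℝ) • y := by rw [hy, smul_inv_smul₀ hg0]
  have hynorm : ‖y‖ ^ 2 = 1 := by
    have h := heik p
    rw [hG, hp, norm_smul, mul_pow] at h
    have h' : (g : ℝ) ^ 2 * ‖y‖ ^ 2 = (g : ℝ) ^ 2 * 1 := by simpa using h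
    exact mul_left_cancel₀ (pow_ne_zero 2 hg0) h'
  have hyp : inner ℝ y p = cos θ := by
    have h := inner_gradient_self_of_homogeneous hF hhom p
    rw [hG, inner_smul_left, hFp] at h
    exact mul_left_cancel₀ hg0 (by simpa using h)
  let ν : E := (sin θ)⁻¹ • (y - cos θ • p)
  have hyν : y = cos θ • p + sin θ • ν := by
    simp only [ν, smul_inv_smul₀ hθ]
    abel
  have hpν : inner ℝ p ν = 0 := by
    simp only [ν, inner_smul_right, inner_sub_right, real_inner_comm y p, hyp,
      real_inner_self_eq_norm_sq, hp]
    ring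
  have hν : ‖ν‖ = 1 := by
    have h : ‖y - cos θ • p‖ ^ 2 = sin θ ^ 2 := by
      rw [norm_sub_sq_real, hynorm, norm_smul, hp, inner_smul_right, hyp, sin_sq]
      simp
      ring
    have h' : ‖ν‖ ^ 2 = 1 := by
      simp only [ν, norm_smul, mul_pow, h]
      simp [hθ]
    nlinarith [norm_nonneg ν]
  have hgrad := gradient_along_normal_circle hg hF hhom heik hp hν hpν hθ
    (by rw [hG, ← hyν]) θ
  rw [← hyν] at hgrad
  have hang : θ - g * θ = -(((g : ℝ) - 1) * θ) := by ring
  rw [hang, cos_neg, sin_neg] at hgrad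
  have hyw : inner ℝ (-sin θ • p + cos θ • ν) y = 0 := by
    rw [hyν]
    simp only [inner_add_left, inner_add_right, inner_smul_left, inner_smul_right,
      real_inner_self_eq_norm_sq, hp, hν, hpν, real_inner_comm p ν]
    simp
    ring
  refine ⟨?_, -sin θ • p + cos θ • ν, ?_, ?_⟩
  · have h := inner_gradient_self_of_homogeneous hF hhom y
    rw [hgrad, inner_smul_left, inner_add_left, inner_smul_left, inner_smul_left, hyw,
      real_inner_self_eq_norm_sq, hynorm] at h
    exact (mul_left_cancel₀ hg0 (by simpa using h)).symm
  · rw [hyν]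
    have hcs := sin_sq_add_cos_sq θ
    match_scalars <;> first | linear_combination -hcs | ring
  · rw [hgrad]
    module

lemma sin_ne_zero_of_mem_Ioo_nat_mul_pi {k : ℕ} {x : ℝ}
    (hx : x ∈ Set.Ioo (((k : ℝ) - 1) * π) (k * π)) : sin x ≠ 0 := by
  intro h
  obtain ⟨m, rfl⟩ := sin_eq_zero_iff.mp h
  have h1 : ((k : ℤ) - 1 : ℝ) < m := by
    exact_mod_cast lt_of_mul_lt_mul_right hx.1 pi_pos.le
  have h2 : (m : ℝ) < (k : ℤ) := by
    exact_mod_cast lt_of_mul_lt_mul_right hx.2 pi_pos.le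
  norm_cast at h1 h2
  lia

lemma injOn_cos_Ioo_nat_mul_pi (k : ℕ) :
    Set.InjOn cos (Set.Ioo (((k : ℝ) - 1) * π) (k * π)) := by
  intro x hx y hy hxy
  have hmid : sin ((x + y) / 2) ≠ 0 := sin_ne_zero_of_mem_Ioo_nat_mul_pi
    (k := k) ⟨by linarith [hx.1, hy.1], by linarith [hx.2, hy.2]⟩
  have h := cos_sub_cos x y
  rw [hxy, sub_self] at h
  have hdiff : sin ((x - y) / 2) = 0 := by
    rcases mul_eq_zero.mp h.symm with h' | h'
    · exact absurd h' (by simpa using hmid)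
    · exact h'
  have hπ := pi_pos
  have h0 := (sin_eq_zero_iff_of_lt_of_lt (by linarith [hx.1, hy.2]) (by linarith [hx.2, hy.1])).mp
    hdiff
  linarith

lemma MvPolynomial.IsHomogeneous.eval_smul_point {σ R : Type*} [CommSemiring R]
    {P : MvPolynomial σ R} {g : ℕ} (hP : P.IsHomogeneous g) (r : R) (x : σ → R) :
    MvPolynomial.eval (r • x) P = r ^ g * MvPolynomial.eval x P := by
  rw [MvPolynomial.eval_eq, MvPolynomial.eval_eq, Finset.mul_sum]
  refine Finset.sum_congr rfl fun d hd ↦ ?_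
  have hdeg : ∑ i ∈ d.support, d i = g := by
    simpa [Finsupp.weight_apply, Finsupp.sum] using hP (MvPolynomial.mem_support_iff.mp hd)
  simp only [Pi.smul_apply, smul_eq_mul, mul_pow, Finset.prod_mul_distrib,
    Finset.prod_pow_eq_pow_sum, hdeg]
  ring

/-- Let `F` be an isoparametric polynomial of degree `g ≥ 2` (a homogeneous
polynomial of degree `g` with `‖∇F(x)‖² = g² ‖x‖^{2g-2}` and `ΔF(x) = c ‖x‖^{g-2}`), let
`Φ = (1/g) ∇F`, and fix `1 ≤ k ≤ g-1`.  If `p, q` on the unit sphere both satisfy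
`arccos(F(·)) ∈ ((k-1)π/(g-1), kπ/(g-1))` and `Φ(p) = Φ(q)`, then `p = q`: the gradient map
is injective on each open band `𝓜_k` of the sphere. -/
theorem gradientMap_injOn_band (n g k : ℕ) (hg : 2 ≤ g) (hk1 : 1 ≤ k) (hk2 : k ≤ g - 1)
    (F : EuclideanSpace ℝ (Fin (n + 2)) → ℝ)
    (P : MvPolynomial (Fin (n + 2)) ℝ) (hP : P.IsHomogeneous g)
    (hFP : ∀ x, F x = MvPolynomial.eval x P)
    (hCM1 : ∀ x, ‖gradient F x‖ ^ 2 = (g : ℝ) ^ 2 * ‖x‖ ^ (2 * g - 2))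
    (c : ℝ) (hCM2 : ∀ x, laplacian F x = c * ‖x‖ ^ (g - 2))
    (Φ : EuclideanSpace ℝ (Fin (n + 2)) → EuclideanSpace ℝ (Fin (n + 2)))
    (hΦ : ∀ x, Φ x = (g : ℝ)⁻¹ • gradient F x)
    (p q : EuclideanSpace ℝ (Fin (n + 2))) (hp : ‖p‖ = 1) (hq : ‖q‖ = 1)
    (hpband : Real.arccos (F p) ∈
      Set.Ioo (((k : ℝ) - 1) * π / ((g : ℝ) - 1)) ((k : ℝ) * π / ((g : ℝ) - 1)))
    (hqband : Real.arccos (F q) ∈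
      Set.Ioo (((k : ℝ) - 1) * π / ((g : ℝ) - 1)) ((k : ℝ) * π / ((g : ℝ) - 1)))
    (hΦpq : Φ p = Φ q) : p = q := by

  have hg1 : 1 ≤ g := by lia
  have hgpos : (0 : ℝ) < (g : ℝ) - 1 := by
    have : (2 : ℝ) ≤ g := by exact_mod_cast hg
    linarith
  have hF : ∀ x, AnalyticAt ℝ F x := by
    intro x
    rw [funext hFP]
    exact AnalyticOnNhd.eval_continuousLinearMap'
      (fun i ↦ (EuclideanSpace.proj i : EuclideanSpace ℝ (Fin (n + 2)) →L[ℝ] ℝ)) P x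
      (Set.mem_univ x)
  have hhom : ∀ (r : ℝ) x, F (r • x) = r ^ g * F x := by
    intro r x
    rw [hFP, hFP]
    exact hP.eval_smul_point r x
  have hscale : ∀ {θ : ℝ}, θ ∈
      Set.Ioo (((k : ℝ) - 1) * π / ((g : ℝ) - 1)) ((k : ℝ) * π / ((g : ℝ) - 1)) →
      ((g : ℝ) - 1) * θ ∈ Set.Ioo (((k : ℝ) - 1) * π) (k * π) := by
    rintro θ ⟨h1, h2⟩
    rw [div_lt_iff₀' hgpos] at h1
    rw [lt_div_iff₀' hgpos] at h2
    exact ⟨h1, h2⟩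
  have hpoint : ∀ {x : EuclideanSpace ℝ (Fin (n + 2))}, arccos (F x) ∈
      Set.Ioo (((k : ℝ) - 1) * π / ((g : ℝ) - 1)) ((k : ℝ) * π / ((g : ℝ) - 1)) →
      F x = cos (arccos (F x)) ∧ sin (arccos (F x)) ≠ 0 := by
    rintro x ⟨h1, h2⟩
    have hk : (1 : ℝ) ≤ k := by exact_mod_cast hk1
    have hkg : (k : ℝ) ≤ (g : ℝ) - 1 := by
      rw [← Nat.cast_one, ← Nat.cast_sub hg1]
      exact_mod_cast hk2
    have hpos : 0 < arccos (F x) :=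
      lt_of_le_of_lt (by have := pi_pos; have : 0 ≤ (k : ℝ) - 1 := by linarith
                         positivity) h1
    have hlt : arccos (F x) < π := by
      refine h2.trans_le ?_
      rw [div_le_iff₀' hgpos]
      exact mul_le_mul_of_nonneg_right hkg pi_pos.le
    have hle : F x ≤ 1 := (arccos_pos.mp hpos).le
    have hge : -1 ≤ F x := by
      by_contra! h
      exact hlt.ne (arccos_eq_pi.mpr h.le)
    exact ⟨(cos_arccos hge hle).symm, (sin_pos_of_pos_of_lt_pi hpos hlt).ne'⟩
  obtain ⟨hFp, hsp⟩ := hpoint hpband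
  obtain ⟨hFq, hsq⟩ := hpoint hqband
  obtain ⟨hcp, v, hpv, hgv⟩ :=
    exists_normal_direction_at_gradientMap hg1 hF hhom hCM1 hp hFp hsp (hΦ p)
  obtain ⟨hcq, w, hqw, hgw⟩ :=
    exists_normal_direction_at_gradientMap hg1 hF hhom hCM1 hq hFq hsq (hΦ q)
  rw [← hΦpq] at hcq hqw hgw
  have hθ : arccos (F p) = arccos (F q) := mul_left_cancel₀ hgpos.ne'
    (injOn_cos_Ioo_nat_mul_pi k (hscale hpband) (hscale hqband) (hcp.symm.trans hcq))
  rw [← hθ] at hqw hgw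
  have hg0 : (g : ℝ) ≠ 0 := by positivity
  have hvw : v = w := smul_right_injective _
    (sin_ne_zero_of_mem_Ioo_nat_mul_pi (hscale hpband))
    (sub_right_injective (smul_right_injective _ hg0 (hgv.symm.trans hgw)))
  rw [hpv, hqw, hvw]
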